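/- Let λ ∈ K^{(𝒯)}, t0 ∈ 𝒯, and let D' = T^{(t0)}_{D,𝒯}. Let ψ_{t0} : g_{D'} → g_{D,𝒯} be the unique linear map satisfying ψ_{t0}(x • y) = ψ_{t0}(x) •_λ ψ_{t0}(y) for all x, y ∈ g_{D'} and sending the single-vertex tree decorated by S ∈ D' to S (it exists and is unique since (g_{D'}, •) is the free prelie algebra on D'). Then ψ_{t0} is bijective if and only if λ_{t0} ≠ 0. -/

import Mathlib

open scoped TensorProduct

/-- Underlying data of a `D`-decorated `T`-typed rooted tree: a root decoration together with a
list of pairs (edge type, subtree). -/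
inductive PreTree (D T : Type) : Type
  | node : D → List (T × PreTree D T) → PreTree D T

namespace PreTree
variable {D T : Type}

/-- One-step rearrangement of children; it generates the identification of trees whose children
form the same multiset of (type, subtree) pairs. -/
inductive Swap : PreTree D T → PreTree D T → Prop
  | swap (d : D) (l₁ l₂ : List (T × PreTree D T)) (p q : T × PreTree D T) :
      Swap (.node d (l₁ ++ p :: q :: l₂)) (.node d (l₁ ++ q :: p :: l₂))
  | congr (d : D) (l₁ l₂ : List (T × PreTree D T)) (t : T) (s s' : PreTree D T) :
      Swap s s' → Swap (.node d (l₁ ++ (t, s) :: l₂)) (.node d (l₁ ++ (t, s') :: l₂))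

end PreTree

instance preTreeSetoid (D T : Type) : Setoid (PreTree D T) :=
  ⟨Relation.EqvGen PreTree.Swap, Relation.EqvGen.is_equivalence _⟩

/-- `D`-decorated `T`-typed rooted trees: the root is decorated by an element of `D` and carries
a finite multiset of pairs (type, subtree). -/
abbrev TypedTree (D T : Type) : Type := Quotient (preTreeSetoid D T)
namespace PreTree
variable {D T : Type}

mutual
/-- The list of all graftings `S •_t^{(v)} S'` of `S'` on a vertex `v` of `S`, the new edge
having type `t` (one entry for each vertex `v` of `S`). -/
def graftAll (t : T) (s' : PreTree D T) : PreTree D T → List (PreTree D T)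
  | .node d l => .node d ((t, s') :: l) :: (graftAllL t s' l).map (fun l' => .node d l')
def graftAllL (t : T) (s' : PreTree D T) :
    List (T × PreTree D T) → List (List (T × PreTree D T))
  | [] => []
  | (u, c) :: rest =>
      ((graftAll t s' c).map fun c' => (u, c') :: rest) ++
      ((graftAllL t s' rest).map fun r => (u, c) :: r)
end

end PreTree

variable (K : Type) [Field K]

/-- `g_{D,T}`: the free `K`-vector space with basis the set of `D`-decorated `T`-typed
rooted trees. -/
abbrev gDT (K D T : Type) [Field K] : Type := TypedTree D T →₀ K

/-- The grafting product `•_t`, defined on basis trees by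
`S •_t S' = Σ_{v ∈ V(S)} S •_t^{(v)} S'`, extended bilinearly. -/
noncomputable def bulletL {D T : Type} (t : T) :
    gDT K D T →ₗ[K] gDT K D T →ₗ[K] gDT K D T :=
  Finsupp.lift (gDT K D T →ₗ[K] gDT K D T) K (TypedTree D T) fun a =>
    Finsupp.lift (gDT K D T) K (TypedTree D T) fun b =>
      ((PreTree.graftAll t b.out a.out).map
        fun r => Finsupp.single (⟦r⟧ : TypedTree D T) (1 : K)).sum
/-- For `λ ∈ K^{(𝒯)}` (finitely supported family of scalars), the product
`•_λ = Σ_t λ_t •_t`. -/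
noncomputable def bulletLam {D T : Type} (lam : T →₀ K) :
    gDT K D T →ₗ[K] gDT K D T →ₗ[K] gDT K D T :=
  lam.sum fun t c => c • bulletL K t
namespace PreTree
/-- The types of the edges outgoing the root. -/
def rootTypes {D T : Type} : PreTree D T → List T
  | .node _ l => l.map Prod.fst
end PreTree

/-- The set `T^{(t0)}_{D,𝒯}` of trees having no edge of type `t0` incident to the root. -/
def NoRootEdge {D T : Type} (t0 : T) (x : TypedTree D T) : Prop :=
  ∃ p : PreTree D T, ⟦p⟧ = x ∧ t0 ∉ p.rootTypes

namespace TypedTree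
variable {D T : Type}

/-- The tree with a single vertex, decorated by `d`. -/
def dot (d : D) : TypedTree D T := ⟦.node d []⟧

/-- Auxiliary version of `TypedTree.graftRoot` on representatives. -/
def preGraftRoot (t : T) : PreTree D T → PreTree D T → PreTree D T
  | .node d l, s => .node d ((t, s) :: l)

theorem preGraftRoot_swap_left (t : T) {a a' : PreTree D T} (s : PreTree D T)
    (h : PreTree.Swap a a') : PreTree.Swap (preGraftRoot t a s) (preGraftRoot t a' s) := by
  cases h with
  | swap d l₁ l₂ p q => exact .swap d ((t, s) :: l₁) l₂ p q
  | congr d l₁ l₂ u c c' h => exact .congr d ((t, s) :: l₁) l₂ u c c' h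

theorem preGraftRoot_swap_right (t : T) (a : PreTree D T) {s s' : PreTree D T}
    (h : PreTree.Swap s s') : PreTree.Swap (preGraftRoot t a s) (preGraftRoot t a s') := by
  cases a with
  | node d l => exact .congr d [] l t s s' h

theorem eqvGen_map {α β : Type*} {r : α → α → Prop} {s : β → β → Prop} (f : α → β)
    (hf : ∀ a b, r a b → s (f a) (f b)) {a b : α} (h : Relation.EqvGen r a b) :
    Relation.EqvGen s (f a) (f b) := by
  induction h with
  | rel _ _ h => exact .rel _ _ (hf _ _ h)
  | refl _ => exact .refl _
  | symm _ _ _ ih => exact .symm _ _ ih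
  | trans _ _ _ _ _ ih₁ ih₂ => exact .trans _ _ _ ih₁ ih₂

/-- Graft a tree onto the root of another one, the new edge having type `t`. -/
def graftRoot (t : T) : TypedTree D T → TypedTree D T → TypedTree D T :=
  Quotient.map₂ (preGraftRoot t) fun _ a' ha s _ hs =>
    .trans _ _ _ (eqvGen_map (preGraftRoot t · s) (fun _ _ => preGraftRoot_swap_left t s) ha)
      (eqvGen_map (preGraftRoot t a') (fun _ _ => preGraftRoot_swap_right t a') hs)

theorem mk_node_cons (d : D) (t : T) (s : PreTree D T) (l : List (T × PreTree D T)) :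
    (⟦.node d ((t, s) :: l)⟧ : TypedTree D T) = graftRoot t ⟦.node d l⟧ ⟦s⟧ := rfl

theorem graftRoot_comm (t u : T) (S A B : TypedTree D T) :
    graftRoot t (graftRoot u S B) A = graftRoot u (graftRoot t S A) B := by
  induction S using Quotient.inductionOn with | _ S
  induction A using Quotient.inductionOn with | _ A
  induction B using Quotient.inductionOn with | _ B
  cases S with
  | node d l => exact Quotient.sound (.rel _ _ (.swap d [] l (t, A) (u, B)))

mutual
theorem mk_induction {P : TypedTree D T → Prop} (hd : ∀ d, P (dot d))
    (hg : ∀ t S A, P S → P A → P (graftRoot t S A)) : ∀ p : PreTree D T, P ⟦p⟧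
  | .node d l => mk_node_induction hd hg d l
theorem mk_node_induction {P : TypedTree D T → Prop} (hd : ∀ d, P (dot d))
    (hg : ∀ t S A, P S → P A → P (graftRoot t S A)) (d : D) :
    ∀ l : List (T × PreTree D T), P ⟦.node d l⟧
  | [] => hd d
  | (t, s) :: l => hg t _ _ (mk_node_induction hd hg d l) (mk_induction hd hg s)
end

@[elab_as_elim]
theorem induction {P : TypedTree D T → Prop} (S : TypedTree D T) (dot : ∀ d, P (dot d))
    (graft : ∀ t S A, P S → P A → P (graftRoot t S A)) : P S :=
  Quotient.inductionOn S (mk_induction dot graft)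

section Fold
variable {X : Type} (base : D → X) (step : T → TypedTree D T → X → TypedTree D T → X → X)

mutual
/-- Auxiliary version of `TypedTree.fold` on representatives. -/
def preFold : PreTree D T → X
  | .node d l => preFoldL d l
/-- Auxiliary version of `TypedTree.fold` on the children of the root of a representative. -/
def preFoldL (d : D) : List (T × PreTree D T) → X
  | [] => base d
  | (t, s) :: l => step t ⟦.node d l⟧ (preFoldL d l) ⟦s⟧ (preFold s)
end

variable (hstep : ∀ t u S x A a B b, step t (graftRoot u S B) (step u S x B b) A a =
  step u (graftRoot t S A) (step t S x A a) B b)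

include hstep in
theorem preFold_swap {p q : PreTree D T} (h : PreTree.Swap p q) :
    preFold base step p = preFold base step q := by
  induction h with
  | swap d l₁ l₂ p q =>
    simp only [preFold]
    induction l₁ with
    | nil =>
      obtain ⟨t, p⟩ := p
      obtain ⟨u, q⟩ := q
      exact hstep t u ⟦.node d l₂⟧ _ ⟦p⟧ _ ⟦q⟧ _
    | cons c l₁ ih =>
      have h : (⟦.node d (l₁ ++ p :: q :: l₂)⟧ : TypedTree D T) =
        ⟦.node d (l₁ ++ q :: p :: l₂)⟧ := Quotient.sound (.rel _ _ (.swap d l₁ l₂ p q))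
      simp only [List.cons_append, preFoldL, ih, h]
  | congr d l₁ l₂ t s s' h ih =>
    simp only [preFold]
    induction l₁ with
    | nil =>
      have h : (⟦s⟧ : TypedTree D T) = ⟦s'⟧ := Quotient.sound (.rel _ _ h)
      simp only [List.nil_append, preFoldL, ih, h]
    | cons c l₁ ihl =>
      have h : (⟦.node d (l₁ ++ (t, s) :: l₂)⟧ : TypedTree D T) =
        ⟦.node d (l₁ ++ (t, s') :: l₂)⟧ := Quotient.sound (.rel _ _ (.congr d l₁ l₂ t s s' h))
      simp only [List.cons_append, preFoldL, h, ihl]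

/-- Recursion on trees, seen as generated by single vertices and graftings onto the root. -/
def fold : TypedTree D T → X :=
  Quotient.lift (preFold base step) fun _ _ h => by
    induction h with
    | rel _ _ h => exact preFold_swap base step hstep h
    | refl _ => rfl
    | symm _ _ _ ih => exact ih.symm
    | trans _ _ _ _ _ ih₁ ih₂ => exact ih₁.trans ih₂

theorem fold_dot (d : D) : fold base step hstep (dot d) = base d := by
  simp [fold, dot, preFold, preFoldL]

theorem fold_graftRoot (t : T) (S A : TypedTree D T) :
    fold base step hstep (graftRoot t S A) =
      step t S (fold base step hstep S) A (fold base step hstep A) := by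
  induction S using Quotient.inductionOn with | _ S
  induction A using Quotient.inductionOn with | _ A
  cases S with
  | node d l => simp [fold, ← mk_node_cons, preFold, preFoldL]

end Fold

section Linear

/-- Bilinear extension of `TypedTree.graftRoot`. -/
noncomputable def graftRootL (t : T) : gDT K D T →ₗ[K] gDT K D T →ₗ[K] gDT K D T :=
  Finsupp.lift (gDT K D T →ₗ[K] gDT K D T) K (TypedTree D T) fun a =>
    Finsupp.lmapDomain K K (graftRoot t a)

@[simp]
theorem graftRootL_single (t : T) (S A : TypedTree D T) :
    graftRootL K t (.single S 1) (.single A 1) = .single (graftRoot t S A) 1 := by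
  simp [graftRootL]

/-- Two bilinear maps agree modulo a submodule on supported functions as soon as they do so on
basis vectors. -/
theorem bilinear_sub_mem {ι κ V : Type*} [AddCommGroup V] [Module K V]
    (f g : (ι →₀ K) →ₗ[K] (κ →₀ K) →ₗ[K] V) (P : Submodule K V) {s : Set ι} {s' : Set κ}
    (h : ∀ i ∈ s, ∀ j ∈ s',
      f (.single i 1) (.single j 1) - g (.single i 1) (.single j 1) ∈ P) {x : ι →₀ K}
    {y : κ →₀ K} (hx : x ∈ Finsupp.supported K K s) (hy : y ∈ Finsupp.supported K K s') :
    f x y - g x y ∈ P := by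
  rw [Finsupp.supported_eq_span_single] at hx hy
  induction hx, hy using Submodule.span_induction₂ with
  | mem_mem x y hx hy =>
    obtain ⟨i, hi, rfl⟩ := hx
    obtain ⟨j, hj, rfl⟩ := hy
    exact h i hi j hj
  | zero_left => simp
  | zero_right => simp
  | add_left _ _ _ _ _ _ h₁ h₂ => simpa [add_sub_add_comm] using P.add_mem h₁ h₂
  | add_right _ _ _ _ _ _ h₁ h₂ => simpa [add_sub_add_comm] using P.add_mem h₁ h₂
  | smul_left r _ _ _ _ h => simpa [smul_sub] using P.smul_mem r h
  | smul_right r _ _ _ _ h => simpa [smul_sub] using P.smul_mem r h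

/-- A bilinear map sends a pair of supported functions to a submodule as soon as it does so for
basis vectors. -/
theorem bilinear_mem {ι κ V : Type*} [AddCommGroup V] [Module K V]
    (f : (ι →₀ K) →ₗ[K] (κ →₀ K) →ₗ[K] V) (P : Submodule K V) {s : Set ι} {s' : Set κ}
    (h : ∀ i ∈ s, ∀ j ∈ s', f (.single i 1) (.single j 1) ∈ P) {x : ι →₀ K} {y : κ →₀ K}
    (hx : x ∈ Finsupp.supported K K s) (hy : y ∈ Finsupp.supported K K s') : f x y ∈ P := by
  simpa using bilinear_sub_mem K f 0 P (by simpa using h) hx hy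

theorem graftRootL_comm (t u : T) (x a b : gDT K D T) :
    graftRootL K t (graftRootL K u x b) a = graftRootL K u (graftRootL K t x a) b := by
  induction x using Finsupp.induction_linear with
  | zero => simp
  | add _ _ h₁ h₂ => simp [h₁, h₂]
  | single S r =>
    induction a using Finsupp.induction_linear with
    | zero => simp
    | add _ _ h₁ h₂ => simp [h₁, h₂]
    | single A rA =>
      induction b using Finsupp.induction_linear with
      | zero => simp
      | add _ _ h₁ h₂ => simp [h₁, h₂]
      | single B rB =>
        rw [← Finsupp.smul_single_one S, ← Finsupp.smul_single_one A, ← Finsupp.smul_single_one B]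
        simp only [map_smul, LinearMap.smul_apply, graftRootL_single]
        rw [graftRoot_comm, smul_comm rA rB]

/-- The sum of all graftings of `B` onto vertices of a tree, defined by recursion. -/
noncomputable def graftSum (t : T) (B : TypedTree D T) : TypedTree D T → gDT K D T :=
  fold (fun d => .single (graftRoot t (dot d) B) 1)
    (fun u S x A y => graftRootL K u x (.single A 1) + graftRootL K u (.single S 1) y)
    fun t u S x A a B b => by
      simp only [map_add, LinearMap.add_apply, ← graftRootL_single]
      rw [graftRootL_comm K t u x, graftRootL_comm K t u _ _ b, graftRootL_comm K t u _ a]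
      abel

theorem graftSum_dot (t : T) (B : TypedTree D T) (d : D) :
    graftSum K t B (dot d) = .single (graftRoot t (dot d) B) 1 := fold_dot ..

theorem graftSum_graftRoot (t u : T) (B S A : TypedTree D T) :
    graftSum K t B (graftRoot u S A) = graftRootL K u (graftSum K t B S) (.single A 1) +
      graftRootL K u (.single S 1) (graftSum K t B A) := fold_graftRoot ..

theorem map_list_sum_graftRootL_left (u : T) (l : List (TypedTree D T)) (A : TypedTree D T) :
    graftRootL K u (l.map fun r => Finsupp.single r (1 : K)).sum (.single A 1) =
      (l.map fun r => Finsupp.single (graftRoot u r A) (1 : K)).sum := by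
  induction l with
  | nil => simp
  | cons _ _ ih => simp [ih]

theorem map_list_sum_graftRootL_right (u : T) (l : List (TypedTree D T)) (S : TypedTree D T) :
    graftRootL K u (.single S 1) (l.map fun r => Finsupp.single r (1 : K)).sum =
      (l.map fun r => Finsupp.single (graftRoot u S r) (1 : K)).sum := by
  induction l with
  | nil => simp
  | cons _ _ ih => simp [ih]

mutual
theorem sum_graftAll (t : T) (s : PreTree D T) : ∀ p : PreTree D T,
    ((PreTree.graftAll t s p).map fun r => Finsupp.single (⟦r⟧ : TypedTree D T) (1 : K)).sum =
      graftSum K t ⟦s⟧ ⟦p⟧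
  | .node d l => by
    rw [← sum_graftAllL t s d l]
    simp [PreTree.graftAll, Function.comp_def, mk_node_cons]
theorem sum_graftAllL (t : T) (s : PreTree D T) (d : D) : ∀ l : List (T × PreTree D T),
    Finsupp.single (graftRoot t ⟦.node d l⟧ ⟦s⟧) 1 + ((PreTree.graftAllL t s l).map fun r =>
      Finsupp.single (⟦.node d r⟧ : TypedTree D T) (1 : K)).sum = graftSum K t ⟦s⟧ ⟦.node d l⟧
  | [] => by
    simp only [PreTree.graftAllL, List.map_nil, List.sum_nil, add_zero]
    exact (graftSum_dot K t ⟦s⟧ d).symm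
  | (u, c) :: l => by
    have h₁ := map_list_sum_graftRootL_left K u
      ((PreTree.graftAllL t s l).map fun r => ⟦.node d r⟧) ⟦c⟧
    have h₂ := map_list_sum_graftRootL_right K u
      ((PreTree.graftAll t s c).map fun r => ⟦r⟧) ⟦.node d l⟧
    simp only [List.map_map, Function.comp_def] at h₁ h₂
    rw [mk_node_cons, graftSum_graftRoot, ← sum_graftAllL t s d l, ← sum_graftAll t s c, h₂,
      map_add, LinearMap.add_apply, h₁, graftRootL_single, graftRoot_comm]
    simp only [PreTree.graftAllL, List.map_append, List.map_map, Function.comp_def, mk_node_cons,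
      List.sum_append]
    abel
end

theorem bulletL_single (t : T) (S B : TypedTree D T) :
    bulletL K t (.single S 1) (.single B 1) = graftSum K t B S := by
  simp [bulletL, sum_graftAll]

theorem bulletL_dot (t : T) (d : D) (b : gDT K D T) :
    bulletL K t (.single (dot d) 1) b = graftRootL K t (.single (dot d) 1) b := by
  induction b using Finsupp.induction_linear with
  | zero => simp
  | add _ _ h₁ h₂ => simp [h₁, h₂]
  | single B r =>
    rw [← Finsupp.smul_single_one B]
    simp only [map_smul, bulletL_single, graftSum_dot, graftRootL_single]

theorem bulletL_graftRootL (t u : T) (x a b : gDT K D T) :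
    bulletL K t (graftRootL K u x a) b =
      graftRootL K u (bulletL K t x b) a + graftRootL K u x (bulletL K t a b) := by
  induction x using Finsupp.induction_linear with
  | zero => simp
  | add _ _ h₁ h₂ => simp only [map_add, LinearMap.add_apply, h₁, h₂]; abel
  | single S r =>
    induction a using Finsupp.induction_linear with
    | zero => simp
    | add _ _ h₁ h₂ => simp only [map_add, LinearMap.add_apply, h₁, h₂]; abel
    | single A rA =>
      induction b using Finsupp.induction_linear with
      | zero => simp
      | add _ _ h₁ h₂ => simp only [map_add, LinearMap.add_apply, h₁, h₂]; abel
      | single B rB =>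
        rw [← Finsupp.smul_single_one S, ← Finsupp.smul_single_one A, ← Finsupp.smul_single_one B]
        simp only [map_smul, LinearMap.smul_apply, graftRootL_single, bulletL_single,
          graftSum_graftRoot, smul_add]
        rw [smul_comm rA rB]

end Linear

section Degree
open Classical in
/-- The number of edges of a tree all of whose predecessors, the edge itself included, have
type `t0`. -/
noncomputable def degree (t0 : T) : TypedTree D T → ℕ :=
  fold (fun _ => 0) (fun t _ x _ y => x + if t = t0 then y + 1 else 0) fun _ _ _ _ _ _ _ _ =>
    Nat.add_right_comm ..

variable {t0 t : T}

@[simp]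
theorem degree_dot (d : D) : degree t0 (dot d : TypedTree D T) = 0 := fold_dot ..

@[simp]
theorem degree_graftRoot_self (S A : TypedTree D T) :
    degree t0 (graftRoot t0 S A) = degree t0 S + degree t0 A + 1 := by
  rw [degree, fold_graftRoot, if_pos rfl, add_assoc]

theorem degree_graftRoot_of_ne (h : t ≠ t0) (S A : TypedTree D T) :
    degree t0 (graftRoot t S A) = degree t0 S := by
  rw [degree, fold_graftRoot, if_neg h, add_zero]

theorem noRootEdge_dot (d : D) : NoRootEdge t0 (dot d : TypedTree D T) :=
  ⟨.node d [], rfl, by simp [PreTree.rootTypes]⟩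

theorem noRootEdge_graftRoot {S : TypedTree D T} (hS : NoRootEdge t0 S) (h : t ≠ t0)
    (A : TypedTree D T) : NoRootEdge t0 (graftRoot t S A) := by
  obtain ⟨⟨d, l⟩, rfl, hp⟩ := hS
  induction A using Quotient.inductionOn with | _ A
  refine ⟨.node d ((t, A) :: l), rfl, ?_⟩
  simp only [PreTree.rootTypes, List.map_cons, List.mem_cons, not_or] at hp ⊢
  exact ⟨h.symm, hp⟩

theorem noRootEdge_iff_degree_eq_zero {S : TypedTree D T} :
    NoRootEdge t0 S ↔ degree t0 S = 0 := by
  constructor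
  · rintro ⟨⟨d, l⟩, rfl, hp⟩
    simp only [PreTree.rootTypes] at hp
    induction l with
    | nil => exact degree_dot d
    | cons c l ih =>
      simp only [List.map_cons, List.mem_cons, not_or] at hp
      rw [mk_node_cons, degree_graftRoot_of_ne (Ne.symm hp.1), ih hp.2]
  · induction S using TypedTree.induction with
    | dot d => exact fun _ => noRootEdge_dot d
    | graft t S A ihS _ =>
      intro h
      by_cases ht : t = t0
      · subst ht; simp at h
      · rw [degree_graftRoot_of_ne ht] at h
        exact noRootEdge_graftRoot (ihS h) ht A

/-- The span of the trees of degree less than `n`. -/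
noncomputable def degreeLT (t0 : T) (n : ℕ) : Submodule K (gDT K D T) :=
  Finsupp.supported K K {S | degree t0 S < n}

variable {K} in
@[simp]
theorem single_mem_degreeLT {S : TypedTree D T} {n : ℕ} :
    Finsupp.single S (1 : K) ∈ degreeLT K t0 n ↔ degree t0 S < n := by
  simp [degreeLT, Finsupp.mem_supported]

variable {K} in
theorem degreeLT_mono {m n : ℕ} (h : m ≤ n) :
    degreeLT K (D := D) t0 m ≤ degreeLT K t0 n :=
  Finsupp.supported_mono fun _ hS => lt_of_lt_of_le hS h

theorem mem_supported_univ {ι : Type*} (x : ι →₀ K) :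
    x ∈ Finsupp.supported K K (Set.univ : Set ι) := by
  simp

variable {K} {x y : gDT K D T} {m n : ℕ}

theorem graftRootL_mem_degreeLT (hx : x ∈ degreeLT K t0 m) (hy : y ∈ degreeLT K t0 n) :
    graftRootL K t0 x y ∈ degreeLT K t0 (m + n) := by
  refine bilinear_mem K _ _ (fun S hS A hA => ?_) hx hy
  simp only [Set.mem_ofPred_eq] at hS hA
  simp only [graftRootL_single, single_mem_degreeLT, degree_graftRoot_self]
  omega

theorem graftRootL_mem_degreeLT_of_ne (h : t ≠ t0) (hx : x ∈ degreeLT K t0 m)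
    (y : gDT K D T) : graftRootL K t x y ∈ degreeLT K t0 m := by
  refine bilinear_mem K _ _ (fun S hS A _ => ?_) hx (mem_supported_univ K y)
  simpa [degree_graftRoot_of_ne h] using hS

theorem bulletL_single_mem_degreeLT (S A : TypedTree D T) :
    bulletL K t (.single S 1) (.single A 1) ∈ degreeLT K t0 (degree t0 S + degree t0 A + 2) := by
  induction S using TypedTree.induction with
  | dot d =>
    rw [bulletL_dot]
    by_cases h : t = t0
    · subst h; simp
    · simp [degree_graftRoot_of_ne h]
  | graft u S S' ih ih' =>
    rw [← graftRootL_single, bulletL_graftRootL]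
    by_cases h : u = t0
    · subst h
      rw [degree_graftRoot_self]
      refine add_mem (degreeLT_mono ?_ (graftRootL_mem_degreeLT ih
        (single_mem_degreeLT.2 (Nat.lt_succ_self _))))
        (degreeLT_mono ?_ (graftRootL_mem_degreeLT
        (single_mem_degreeLT.2 (Nat.lt_succ_self _)) ih')) <;> omega
    · rw [degree_graftRoot_of_ne h]
      exact add_mem (graftRootL_mem_degreeLT_of_ne h ih _) (graftRootL_mem_degreeLT_of_ne h
        (single_mem_degreeLT.2 (by omega)) _)

theorem bulletL_single_mem_degreeLT_of_ne (h : t ≠ t0) (S A : TypedTree D T) :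
    bulletL K t (.single S 1) (.single A 1) ∈ degreeLT K t0 (degree t0 S + 1) := by
  induction S using TypedTree.induction with
  | dot d => simp [bulletL_dot, degree_graftRoot_of_ne h]
  | graft u S S' ih ih' =>
    rw [← graftRootL_single, bulletL_graftRootL]
    by_cases hu : u = t0
    · subst hu
      rw [degree_graftRoot_self]
      refine add_mem (degreeLT_mono ?_ (graftRootL_mem_degreeLT ih
        (single_mem_degreeLT.2 (Nat.lt_succ_self _))))
        (degreeLT_mono ?_ (graftRootL_mem_degreeLT
        (single_mem_degreeLT.2 (Nat.lt_succ_self _)) ih')) <;> omega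
    · rw [degree_graftRoot_of_ne hu]
      exact add_mem (graftRootL_mem_degreeLT_of_ne hu ih _) (graftRootL_mem_degreeLT_of_ne hu
        (single_mem_degreeLT.2 (by omega)) _)

theorem bulletL_mem_degreeLT (t : T) (hx : x ∈ degreeLT K t0 m) (hy : y ∈ degreeLT K t0 n) :
    bulletL K t x y ∈ degreeLT K t0 (m + n) := by
  refine bilinear_mem K _ _ (fun S hS A hA => ?_) hx hy
  simp only [Set.mem_ofPred_eq] at hS hA
  exact degreeLT_mono (by omega) (bulletL_single_mem_degreeLT S A)

theorem bulletL_mem_degreeLT_of_ne (h : t ≠ t0) (hx : x ∈ degreeLT K t0 m)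
    (y : gDT K D T) : bulletL K t x y ∈ degreeLT K t0 m := by
  refine bilinear_mem K _ _ (fun S hS A _ => ?_) hx (mem_supported_univ K y)
  exact degreeLT_mono hS (bulletL_single_mem_degreeLT_of_ne h S A)

theorem bulletLam_apply (lam : T →₀ K) (x y : gDT K D T) :
    bulletLam K lam x y = lam.sum fun t c => c • bulletL K t x y := by
  simp [bulletLam, Finsupp.sum, LinearMap.sum_apply]

theorem bulletLam_mem_degreeLT (lam : T →₀ K) (hx : x ∈ degreeLT K t0 m)
    (hy : y ∈ degreeLT K t0 n) : bulletLam K lam x y ∈ degreeLT K t0 (m + n) := by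
  rw [bulletLam_apply]
  exact sum_mem fun t _ => Submodule.smul_mem _ _ (bulletL_mem_degreeLT t hx hy)

theorem bulletLam_sub_mem_degreeLT (lam : T →₀ K) (hx : x ∈ degreeLT K t0 m)
    (y : gDT K D T) : bulletLam K lam x y - lam t0 • bulletL K t0 x y ∈ degreeLT K t0 m := by
  classical
  have h : bulletLam K lam x y =
      lam t0 • bulletL K t0 x y + (lam.erase t0).sum fun t c => c • bulletL K t x y := by
    rw [bulletLam_apply]
    exact (Finsupp.add_sum_erase' lam t0 (fun t c => c • bulletL K t x y) (by simp)).symm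
  rw [h, add_sub_cancel_left]
  refine sum_mem fun t ht => Submodule.smul_mem _ _ (bulletL_mem_degreeLT_of_ne ?_ hx y)
  rintro rfl
  simp at ht

/-- If the degree of `S` vanishes, grafting on non-root vertices does not increase it. -/
theorem bulletL_sub_graftRootL_mem {S : TypedTree D T} (hS : degree t0 S = 0) (b : gDT K D T) :
    bulletL K t0 (.single S 1) b - graftRootL K t0 (.single S 1) b ∈ degreeLT K t0 1 := by
  induction S using TypedTree.induction with
  | dot d => simp [bulletL_dot]
  | graft u S A ih _ =>
    by_cases hu : u = t0
    · subst hu; simp at hS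
    · rw [degree_graftRoot_of_ne hu] at hS
      rw [← graftRootL_single, bulletL_graftRootL, graftRootL_comm, add_sub_right_comm,
        ← LinearMap.map_sub₂]
      exact add_mem (graftRootL_mem_degreeLT_of_ne hu (ih hS) _)
        (graftRootL_mem_degreeLT_of_ne hu (by simp [hS]) _)

end Degree

section Regroup
variable (t0 : T)

/-- Trees decorated by trees without root edges of type `t0` are regrouped into trees by
reading all their edges as edges of type `t0`. -/
def flatten : TypedTree {x : TypedTree D T // NoRootEdge t0 x} Unit → TypedTree D T :=
  fold (fun R => R.1) (fun _ _ x _ y => graftRoot t0 x y) fun _ _ _ _ _ _ _ _ =>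
    graftRoot_comm ..

@[simp]
theorem flatten_dot (R : {x : TypedTree D T // NoRootEdge t0 x}) :
    flatten t0 (dot R) = R.1 := fold_dot ..

@[simp]
theorem flatten_graftRoot (u : Unit) (X Y : TypedTree {x : TypedTree D T // NoRootEdge t0 x} Unit) :
    flatten t0 (graftRoot u X Y) = graftRoot t0 (flatten t0 X) (flatten t0 Y) :=
  fold_graftRoot ..

/-- Change the decoration of the root of a tree. -/
def mapRoot {D' : Type} (f : D' → D') : TypedTree D' T → TypedTree D' T :=
  fold (fun R => dot (f R)) (fun t _ x A _ => graftRoot t x A) fun _ _ _ _ _ _ _ _ =>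
    graftRoot_comm ..

@[simp]
theorem mapRoot_dot {D' : Type} (f : D' → D') (R : D') :
    mapRoot f (dot R : TypedTree D' T) = dot (f R) := fold_dot ..

@[simp]
theorem mapRoot_graftRoot {D' : Type} (f : D' → D') (t : T) (X Y : TypedTree D' T) :
    mapRoot f (graftRoot t X Y) = graftRoot t (mapRoot f X) Y := fold_graftRoot ..

theorem mapRoot_mapRoot {D' : Type} (f g : D' → D') (X : TypedTree D' T) :
    mapRoot f (mapRoot g X) = mapRoot (f ∘ g) X := by
  induction X using TypedTree.induction with
  | dot R => simp
  | graft t X Y ih _ => simp [ih]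

/-- Graft a tree onto the root of a tree without root edges of type `t0`, the new edge having a
type different from `t0`. -/
def graftRootSubtype {t : T} (h : t ≠ t0) (A : TypedTree D T)
    (R : {x : TypedTree D T // NoRootEdge t0 x}) : {x : TypedTree D T // NoRootEdge t0 x} :=
  ⟨graftRoot t R.1 A, noRootEdge_graftRoot R.2 h A⟩

open Classical in
/-- The inverse of `TypedTree.flatten`. -/
noncomputable def regroup :
    TypedTree D T → TypedTree {x : TypedTree D T // NoRootEdge t0 x} Unit :=
  fold (fun d => dot ⟨dot d, noRootEdge_dot d⟩)
    (fun t _ x A y => if h : t = t0 then graftRoot () x y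
      else mapRoot (graftRootSubtype t0 h A) x) fun t u S x A a B b => by
    by_cases ht : t = t0 <;> by_cases hu : u = t0 <;>
      simp only [ht, hu, dite_true, dite_false, mapRoot_graftRoot]
    · exact graftRoot_comm ..
    · simp only [mapRoot_mapRoot]
      congr 1
      funext R
      exact Subtype.ext (graftRoot_comm ..)

variable {t0}

@[simp]
theorem regroup_dot (d : D) :
    regroup t0 (dot d : TypedTree D T) = dot ⟨dot d, noRootEdge_dot d⟩ := fold_dot ..

@[simp]
theorem regroup_graftRoot_self (S A : TypedTree D T) :
    regroup t0 (graftRoot t0 S A) = graftRoot () (regroup t0 S) (regroup t0 A) := by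
  rw [regroup, fold_graftRoot, dif_pos rfl]

theorem regroup_graftRoot_of_ne {t : T} (h : t ≠ t0) (S A : TypedTree D T) :
    regroup t0 (graftRoot t S A) = mapRoot (graftRootSubtype t0 h A) (regroup t0 S) := by
  rw [regroup, fold_graftRoot, dif_neg h]

theorem regroup_of_noRootEdge (S : TypedTree D T) (hS : NoRootEdge t0 S) :
    regroup t0 S = dot ⟨S, hS⟩ := by
  induction S using TypedTree.induction with
  | dot d => simp
  | graft t S A ih _ =>
    have h := noRootEdge_iff_degree_eq_zero.1 hS
    by_cases ht : t = t0
    · subst ht; simp at h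
    · rw [degree_graftRoot_of_ne ht] at h
      rw [regroup_graftRoot_of_ne ht, ih (noRootEdge_iff_degree_eq_zero.2 h), mapRoot_dot]
      rfl

theorem regroup_flatten (X : TypedTree {x : TypedTree D T // NoRootEdge t0 x} Unit) :
    regroup t0 (flatten t0 X) = X := by
  induction X using TypedTree.induction with
  | dot R => simpa using regroup_of_noRootEdge R.1 R.2
  | graft t X Y ih ih' => simp [ih, ih']

theorem flatten_mapRoot {t : T} (h : t ≠ t0) (A : TypedTree D T)
    (X : TypedTree {x : TypedTree D T // NoRootEdge t0 x} Unit) :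
    flatten t0 (mapRoot (graftRootSubtype t0 h A) X) = graftRoot t (flatten t0 X) A := by
  induction X using TypedTree.induction with
  | dot R => simp [graftRootSubtype]
  | graft _ X Y ih _ => simp [ih, graftRoot_comm t0 t]

theorem flatten_regroup (S : TypedTree D T) : flatten t0 (regroup t0 S) = S := by
  induction S using TypedTree.induction with
  | dot d => simp
  | graft t S A ih ih' =>
    by_cases ht : t = t0
    · subst ht; simp [ih, ih']
    · rw [regroup_graftRoot_of_ne ht, flatten_mapRoot, ih]

variable (t0) in
/-- `TypedTree.flatten` as a bijection. -/
noncomputable def flattenEquiv :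
    TypedTree {x : TypedTree D T // NoRootEdge t0 x} Unit ≃ TypedTree D T :=
  ⟨flatten t0, regroup t0, regroup_flatten, flatten_regroup⟩

theorem degree_flatten (X : TypedTree {x : TypedTree D T // NoRootEdge t0 x} Unit) :
    degree t0 (flatten t0 X) = degree () X := by
  induction X using TypedTree.induction with
  | dot R => simpa using noRootEdge_iff_degree_eq_zero.1 R.2
  | graft _ X Y ih ih' =>
    rw [flatten_graftRoot, degree_graftRoot_self, ih, ih']
    exact (degree_graftRoot_self X Y).symm

end Regroup

section Generation
variable {K}

/-- Iterated root graftings of `k` elements of a graded family of submodules on single vertices;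
the second index is the degree. -/
inductive GraftPow (M : ℕ → Submodule K (gDT K D Unit)) : ℕ → ℕ → gDT K D Unit → Prop
  | zero (k n) : GraftPow M k n 0
  | dot (d : D) : GraftPow M 0 0 (.single (dot d) 1)
  | add {k n x y} : GraftPow M k n x → GraftPow M k n y → GraftPow M k n (x + y)
  | graft {k m n x y} : GraftPow M k m x → y ∈ M n →
      GraftPow M (k + 1) (m + n + 1) (graftRootL K () x y)

variable {M : ℕ → Submodule K (gDT K D Unit)}
  (hmul : ∀ m n x y, x ∈ M m → y ∈ M n → bulletL K () x y ∈ M (m + n + 1))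

include hmul in
theorem GraftPow.exists_bulletL {k m n : ℕ} {x y : gDT K D Unit} (hx : GraftPow M k m x)
    (hy : y ∈ M n) :
    ∃ z, GraftPow M k (m + n + 1) z ∧ bulletL K () x y = graftRootL K () x y + z := by
  induction hx with
  | zero k n => exact ⟨0, .zero _ _, by simp⟩
  | dot d => exact ⟨0, .zero _ _, by simp [bulletL_dot]⟩
  | add _ _ ih ih' =>
    obtain ⟨z, hz, h⟩ := ih
    obtain ⟨z', hz', h'⟩ := ih'
    refine ⟨z + z', hz.add hz', ?_⟩
    simp only [map_add, LinearMap.add_apply, h, h']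
    abel
  | @graft k m j x a hx ha ih =>
    obtain ⟨z, hz, h⟩ := ih
    refine ⟨graftRootL K () z a + graftRootL K () x (bulletL K () a y), .add ?_ ?_, ?_⟩
    · convert hz.graft ha using 1
      omega
    · convert hx.graft (hmul _ _ _ _ ha hy) using 1
      omega
    · rw [bulletL_graftRootL, h, map_add, LinearMap.add_apply, graftRootL_comm]
      abel

variable (hdot : ∀ d, .single (TypedTree.dot d) 1 ∈ M 0)

include hmul hdot in
theorem GraftPow.mem {k n : ℕ} {x : gDT K D Unit} (hx : GraftPow M k n x) : x ∈ M n := by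
  induction k using Nat.strong_induction_on generalizing n x with | _ k ihk
  induction hx with
  | zero k n => exact zero_mem _
  | dot d => exact hdot d
  | add _ _ ih ih' => exact add_mem (ih ihk) (ih' ihk)
  | graft hx ha _ =>
    obtain ⟨z, hz, h⟩ := GraftPow.exists_bulletL hmul hx ha
    rw [eq_sub_of_add_eq h.symm]
    exact sub_mem (hmul _ _ _ _ (ihk _ (Nat.lt_succ_self _) hx) ha)
      (ihk _ (Nat.lt_succ_self _) hz)

include hmul hdot in
/-- Single vertices generate all trees under the grafting product, in a graded way. -/
theorem single_mem_of_closed (X : TypedTree D Unit) : .single X 1 ∈ M (degree () X) := by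
  suffices h : ∃ k, GraftPow M k (degree () X) (.single X 1) by
    obtain ⟨k, h⟩ := h
    exact h.mem hmul hdot
  induction X using TypedTree.induction with
  | dot d => exact ⟨0, by simpa using GraftPow.dot d⟩
  | graft _ X Y ih ih' =>
    obtain ⟨k, h⟩ := ih
    obtain ⟨k', h'⟩ := ih'
    exact ⟨k + 1, by simpa using h.graft (h'.mem hmul hdot)⟩

end Generation

section Leading
variable {K} {t0 : T}

/-- The linear extension of `TypedTree.flatten`. -/
noncomputable def flattenL (K : Type) [Field K] (t0 : T) :
    gDT K {x : TypedTree D T // NoRootEdge t0 x} Unit →ₗ[K] gDT K D T :=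
  Finsupp.lmapDomain K K (flatten t0)

@[simp]
theorem flattenL_single (X : TypedTree {x : TypedTree D T // NoRootEdge t0 x} Unit) (r : K) :
    flattenL K t0 (.single X r) = .single (flatten t0 X) r := by
  simp [flattenL]

theorem flattenL_graftRootL (x y : gDT K {x : TypedTree D T // NoRootEdge t0 x} Unit) :
    flattenL K t0 (graftRootL K () x y) =
      graftRootL K t0 (flattenL K t0 x) (flattenL K t0 y) := by
  induction x using Finsupp.induction_linear with
  | zero => simp
  | add _ _ h₁ h₂ => simp [h₁, h₂]
  | single X r =>
    induction y using Finsupp.induction_linear with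
    | zero => simp
    | add _ _ h₁ h₂ => simp [h₁, h₂]
    | single Y rA =>
      rw [← Finsupp.smul_single_one X, ← Finsupp.smul_single_one Y]
      simp only [map_smul, LinearMap.smul_apply, graftRootL_single, flattenL_single,
        flatten_graftRoot]

theorem bulletL_single_flatten_sub_mem (X Y : TypedTree {x : TypedTree D T // NoRootEdge t0 x} Unit) :
    bulletL K t0 (.single (flatten t0 X) 1) (.single (flatten t0 Y) 1) -
      flattenL K t0 (bulletL K () (.single X 1) (.single Y 1)) ∈
      degreeLT K t0 (degree () X + degree () Y + 1) := by
  have hlt (X : TypedTree {x : TypedTree D T // NoRootEdge t0 x} Unit) :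
      .single (flatten t0 X) 1 ∈ degreeLT K t0 (degree () X + 1) := by
    simp [degree_flatten]
  induction X using TypedTree.induction with
  | dot R =>
    rw [bulletL_dot, flattenL_graftRootL]
    simp only [flattenL_single, flatten_dot]
    exact degreeLT_mono (by omega)
      (bulletL_sub_graftRootL_mem (noRootEdge_iff_degree_eq_zero.1 R.2) _)
  | graft _ X A ih ih' =>
    rw [flatten_graftRoot, ← graftRootL_single, ← graftRootL_single, bulletL_graftRootL,
      bulletL_graftRootL, map_add, flattenL_graftRootL, flattenL_graftRootL, add_sub_add_comm,
      flattenL_single, flattenL_single, ← LinearMap.map_sub₂,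
      ← map_sub (graftRootL K t0 (.single (flatten t0 X) 1)), degree_graftRoot_self]
    refine add_mem (degreeLT_mono ?_ (graftRootL_mem_degreeLT ih (hlt A)))
      (degreeLT_mono ?_ (graftRootL_mem_degreeLT (hlt X) ih')) <;> omega

/-- The span of the trees of degree `n`. -/
noncomputable def degreeEQ (K : Type) [Field K] (t0 : T) (n : ℕ) : Submodule K (gDT K D T) :=
  Finsupp.supported K K {S | degree t0 S = n}

theorem single_mem_degreeEQ (S : TypedTree D T) :
    .single S 1 ∈ degreeEQ K t0 (degree t0 S) := by
  simp [degreeEQ, Finsupp.mem_supported]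

theorem graftRootL_mem_degreeEQ {m n : ℕ} {x y : gDT K D T} (hx : x ∈ degreeEQ K t0 m)
    (hy : y ∈ degreeEQ K t0 n) : graftRootL K t0 x y ∈ degreeEQ K t0 (m + n + 1) := by
  refine bilinear_mem K _ _ (fun S hS A hA => ?_) hx hy
  obtain rfl : degree t0 S = m := hS
  obtain rfl : degree t0 A = n := hA
  rw [graftRootL_single, ← degree_graftRoot_self]
  exact single_mem_degreeEQ _

theorem bulletL_unit_mem_degreeEQ {m n : ℕ} {x y : gDT K D Unit}
    (hx : x ∈ degreeEQ K () m) (hy : y ∈ degreeEQ K () n) :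
    bulletL K () x y ∈ degreeEQ K () (m + n + 1) := by
  refine bilinear_mem K _ _ (fun S hS A hA => ?_) hx hy
  obtain rfl : degree () S = m := hS
  obtain rfl : degree () A = n := hA
  clear hx hy
  induction S using TypedTree.induction with
  | dot d =>
    rw [bulletL_dot]
    exact graftRootL_mem_degreeEQ (single_mem_degreeEQ _) (single_mem_degreeEQ _)
  | graft _ S B ih ih' =>
    rw [← graftRootL_single, bulletL_graftRootL, degree_graftRoot_self]
    refine add_mem ?_ ?_
    · convert graftRootL_mem_degreeEQ (ih) (single_mem_degreeEQ B) using 1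
      congr 1
      omega
    · convert graftRootL_mem_degreeEQ (single_mem_degreeEQ S) (ih') using 1
      congr 1
      omega

theorem flattenL_mem_degreeLT {n : ℕ}
    {x : gDT K {x : TypedTree D T // NoRootEdge t0 x} Unit} (hx : x ∈ degreeEQ K () n) :
    flattenL K t0 x ∈ degreeLT K t0 (n + 1) := by
  rw [degreeEQ, Finsupp.supported_eq_span_single] at hx
  induction hx using Submodule.span_induction with
  | mem _ h =>
    obtain ⟨X, rfl, rfl⟩ := h
    simp [degree_flatten]
  | zero => simp
  | add _ _ _ _ h₁ h₂ => simpa using add_mem h₁ h₂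
  | smul r _ _ h => simpa using Submodule.smul_mem _ r h

/-- Up to terms of lower degree, `TypedTree.flattenL` is a morphism to the product `•_{t0}`. -/
theorem bulletL_flattenL_sub_mem {m n : ℕ}
    {x y : gDT K {x : TypedTree D T // NoRootEdge t0 x} Unit} (hx : x ∈ degreeEQ K () m)
    (hy : y ∈ degreeEQ K () n) :
    bulletL K t0 (flattenL K t0 x) (flattenL K t0 y) - flattenL K t0 (bulletL K () x y) ∈
      degreeLT K t0 (m + n + 1) := by
  refine bilinear_sub_mem K ((bulletL K t0).compl₁₂ (flattenL K t0) (flattenL K t0))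
    ((bulletL K ()).compr₂ (flattenL K t0)) _ (fun X hX Y hY => ?_) hx hy
  obtain rfl : degree () X = m := hX
  obtain rfl : degree () Y = n := hY
  simpa using bulletL_single_flatten_sub_mem (K := K) X Y

variable {lam : T →₀ K} {ψ : gDT K {x : TypedTree D T // NoRootEdge t0 x} Unit →ₗ[K] gDT K D T}
  (hmul : ∀ x y, ψ (bulletL K () x y) = bulletLam K lam (ψ x) (ψ y))
  (hgen : ∀ S : {x : TypedTree D T // NoRootEdge t0 x},
    ψ (.single (dot S) 1) = .single S.1 1)

include hmul hgen in
theorem map_single_mem_degreeLT_one (h : lam t0 = 0)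
    (X : TypedTree {x : TypedTree D T // NoRootEdge t0 x} Unit) :
    ψ (.single X 1) ∈ degreeLT K t0 1 := by
  refine single_mem_of_closed (M := fun _ => (degreeLT K t0 1).comap ψ) ?_ ?_ X
  · intro _ _ x y hx _
    simpa [hmul, h] using bulletLam_sub_mem_degreeLT lam (Submodule.mem_comap.1 hx) (ψ y)
  · intro R
    simpa [hgen] using noRootEdge_iff_degree_eq_zero.1 R.2

include hmul hgen in
theorem map_single_sub_mem_degreeLT
    (X : TypedTree {x : TypedTree D T // NoRootEdge t0 x} Unit) :
    ψ (.single X 1) - lam t0 ^ degree () X • .single (flatten t0 X) 1 ∈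
      degreeLT K t0 (degree () X) := by
  have key := single_mem_of_closed (M := fun n => degreeEQ K () n ⊓
    (degreeLT K t0 n).comap (ψ - lam t0 ^ n • flattenL K t0)) ?_ ?_ X
  · simpa using key.2
  · rintro m n x y ⟨hx, hx'⟩ ⟨hy, hy'⟩
    refine ⟨bulletL_unit_mem_degreeEQ hx hy, ?_⟩
    simp only [SetLike.mem_coe, Submodule.mem_comap, LinearMap.sub_apply,
      LinearMap.smul_apply] at hx' hy' ⊢
    have hfx := flattenL_mem_degreeLT hx
    have hfy := flattenL_mem_degreeLT hy
    have hψy : ψ y ∈ degreeLT K t0 (n + 1) := by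
      rw [← sub_add_cancel (ψ y) (lam t0 ^ n • flattenL K t0 y)]
      exact add_mem (degreeLT_mono (Nat.le_succ n) hy') (Submodule.smul_mem _ _ hfy)
    have h₁ := bulletLam_mem_degreeLT lam hx' hψy
    have h₂ := bulletLam_mem_degreeLT lam (Submodule.smul_mem _ (lam t0 ^ m) hfx) hy'
    have h₃ := Submodule.smul_mem _ (lam t0 ^ m * lam t0 ^ n)
      (bulletLam_sub_mem_degreeLT lam hfx (flattenL K t0 y))
    have h₄ := bulletL_flattenL_sub_mem hx hy
    have h₅ := Submodule.smul_mem _ (lam t0 ^ (m + n + 1)) h₄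
    have h := add_mem (add_mem h₁ (degreeLT_mono (by omega : m + 1 + n ≤ m + (n + 1)) h₂))
      (add_mem (degreeLT_mono (by omega : m + 1 ≤ m + (n + 1)) h₃) h₅)
    refine (congrArg (· ∈ degreeLT K t0 (m + n + 1)) ?_).mpr h
    simp only [hmul, map_sub, LinearMap.sub_apply, map_smul, LinearMap.smul_apply]
    module
  · intro R
    have h := degree_dot (t0 := ()) R
    exact ⟨h ▸ single_mem_degreeEQ (t0 := ()) (dot R), by simp [hgen]⟩

end Leading
end TypedTree

/-- A linear endomorphism which is triangular with nonzero diagonal entries, with respect to a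
function to the natural numbers on the basis, is bijective. -/
theorem bijective_of_triangular {K : Type} [Field K] {ι κ : Type*} (e : ι ≃ κ) (deg : κ → ℕ)
    (u : ι → K) (hu : ∀ i, u i ≠ 0) (f : (ι →₀ K) →ₗ[K] (κ →₀ K))
    (hf : ∀ i, f (.single i 1) - u i • .single (e i) 1 ∈
      Finsupp.supported K K {j | deg j < deg (e i)}) : Function.Bijective f := by
  classical
  constructor
  · rw [← LinearMap.ker_eq_bot, LinearMap.ker_eq_bot']
    intro x hx
    by_contra hne
    obtain ⟨i, hi, hmax⟩ := x.support.exists_max_image (fun i => deg (e i))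
      (Finsupp.support_nonempty_iff.2 hne)
    have hij : ∀ j ∈ x.support, j ≠ i → x j * f (.single j 1) (e i) = 0 := by
      intro j hj hji
      have h := Finsupp.mem_supported' .. |>.1 (hf j) (e i) (by simpa using hmax j hj)
      rw [Finsupp.sub_apply, Finsupp.smul_apply,
        Finsupp.single_eq_of_ne (by simpa using hji.symm), smul_zero, sub_zero] at h
      rw [h, mul_zero]
    have hii : f (.single i 1) (e i) = u i := by
      have h := Finsupp.mem_supported' .. |>.1 (hf i) (e i) (by simp)
      simpa [sub_eq_zero] using h
    have h0 : f x (e i) = x i * u i := by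
      conv_lhs => rw [← Finsupp.sum_single x]
      rw [Finsupp.sum, map_sum, Finsupp.finsetSum_apply, Finset.sum_eq_single_of_mem i hi, ← hii]
      · rw [← Finsupp.smul_single_one i, map_smul]; rfl
      · intro j hj hji
        rw [← Finsupp.smul_single_one j, map_smul]
        exact hij j hj hji
    rw [hx] at h0
    exact mul_ne_zero (Finsupp.mem_support_iff.1 hi) (hu i) h0.symm
  · rw [← LinearMap.range_eq_top, eq_top_iff]
    have hs : ∀ n, Finsupp.supported K K {j | deg j < n} ≤ LinearMap.range f := by
      intro n
      induction n with
      | zero => simp [Finsupp.supported_empty]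
      | succ n ih =>
        rw [Finsupp.supported_eq_span_single, Submodule.span_le]
        rintro _ ⟨j, hj, rfl⟩
        obtain ⟨i, rfl⟩ := e.surjective j
        have h := (LinearMap.range f).sub_mem (LinearMap.mem_range_self f (.single i 1)) (ih (Finsupp.supported_mono
          (fun k (hk : deg k < _) => hk.trans_le (Nat.le_of_lt_succ hj)) (hf i)))
        rw [sub_sub_cancel] at h
        exact (Submodule.smul_mem_iff _ (hu i)).1 h
    rw [← Finsupp.supported_univ, Finsupp.supported_eq_span_single, Submodule.span_le]
    rintro _ ⟨j, -, rfl⟩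
    exact hs (deg j + 1) (Finsupp.single_mem_supported K 1 (Nat.lt_succ_self (deg j)))

/-- Let `D' = T^{(t0)}_{D,𝒯}` and let `ψ_{t0} : g_{D'} → g_{D,𝒯}` be the
unique linear map satisfying `ψ(x • y) = ψ(x) •_λ ψ(y)` (where `•` is the grafting prelie
product on untyped `D'`-decorated trees) and sending the single-vertex tree decorated by
`S ∈ D'` to `S`.  Then `ψ_{t0}` is bijective if and only if `λ_{t0} ≠ 0`. -/
theorem psi_bijective_iff (K : Type) [Field K] (D T : Type) [Nonempty D] [Nonempty T]
    (lam : T →₀ K) (t0 : T)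
    (ψ : gDT K {x : TypedTree D T // NoRootEdge t0 x} Unit →ₗ[K] gDT K D T)
    (hmul : ∀ x y : gDT K {x : TypedTree D T // NoRootEdge t0 x} Unit,
      ψ (bulletL K () x y) = bulletLam K lam (ψ x) (ψ y))
    (hgen : ∀ S : {x : TypedTree D T // NoRootEdge t0 x},
      ψ (Finsupp.single
          (⟦PreTree.node S []⟧ : TypedTree {x : TypedTree D T // NoRootEdge t0 x} Unit)
          (1 : K)) =
        Finsupp.single S.1 (1 : K)) :
    Function.Bijective ψ ↔ lam t0 ≠ 0 := by
  constructor
  · rintro ⟨-, hsurj⟩ h0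
    obtain ⟨d⟩ := ‹Nonempty D›
    have hrange : ∀ x, ψ x ∈ TypedTree.degreeLT K t0 1 := by
      intro x
      induction x using Finsupp.induction_linear with
      | zero => simp
      | add _ _ h₁ h₂ => simpa using add_mem h₁ h₂
      | single X r =>
        rw [← Finsupp.smul_single_one X, map_smul]
        exact Submodule.smul_mem _ _ (TypedTree.map_single_mem_degreeLT_one hmul hgen h0 X)
    obtain ⟨x, hx⟩ := hsurj (.single (TypedTree.graftRoot t0 (.dot d) (.dot d)) 1)
    simpa [hx] using hrange x
  · intro h
    refine bijective_of_triangular (TypedTree.flattenEquiv t0) (TypedTree.degree t0)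
      (fun X => lam t0 ^ TypedTree.degree () X) (fun _ => pow_ne_zero _ h) ψ fun X => ?_
    have hX := TypedTree.map_single_sub_mem_degreeLT hmul hgen X
    rw [← TypedTree.degree_flatten] at hX
    rwa [← TypedTree.degree_flatten]
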